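/- Let R be a commutative noetherian ring and I an ideal. The extension closure of mod_I(R) — the smallest subcategory of finitely generated R-modules containing mod_I(R) and closed under finite direct sums, direct summands, and extensions — equals mod_{V(I)}(R), the subcategory of finitely generated R-modules that are locally free on Spec R ∖ V(I). -/

import Mathlib

open IsLocalRing

/-- a lies in the stable annihilator of M: multiplication by a on M factors
through a finitely generated projective R-module. -/
def StablyAnn (R : Type) [CommRing R] (M : Type) [AddCommGroup M] [Module R M] (a : R) : Prop :=
  ∃ (P : Type) (_ : AddCommGroup P) (_ : Module R P),
    Module.Finite R P ∧ Module.Projective R P ∧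
    ∃ (f : M →ₗ[R] P) (g : P →ₗ[R] M), g ∘ₗ f = a • (LinearMap.id : M →ₗ[R] M)

/-- The Ext module of two module-category objects. -/
noncomputable def ExtMod (R : Type) [CommRing R] (n : ℕ) (M N : ModuleCat.{0} R) : ModuleCat R :=
  ((Ext R (ModuleCat.{0} R) n).obj (Opposite.op M)).obj N

/-- K is an n-th syzygy of M: there is an exact sequence
0 → K → F_{n-1} → ... → F_0 → M → 0 with finitely generated free modules F_i. -/
def IsSyzygyCat (R : Type) [CommRing R] : ℕ → ModuleCat.{0} R → ModuleCat.{0} R → Prop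
  | 0, K, M => Nonempty (K ≃ₗ[R] M)
  | n + 1, K, M =>
      ∃ (s : ℕ) (p : (Fin s → R) →ₗ[R] M), Function.Surjective p ∧
        IsSyzygyCat R n K (ModuleCat.of R (LinearMap.ker p))

/-- M is a direct summand of Z. -/
def IsSummand (R : Type) [CommRing R] (M Z : ModuleCat.{0} R) : Prop :=
  ∃ (i : M →ₗ[R] Z) (p : Z →ₗ[R] M), p ∘ₗ i = LinearMap.id

/-- The class |X|_n of modules built from X by n-1 extensions together with
finite direct sums and direct summands. -/
def Ball (R : Type) [CommRing R] (X : ModuleCat.{0} R) : ℕ → ModuleCat.{0} R → Prop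
  | 0, M => Subsingleton M
  | 1, M => ∃ s : ℕ, IsSummand R M (ModuleCat.of R (Fin s → X))
  | (n + 2), M =>
      ∃ (A Z B : ModuleCat.{0} R) (f : A →ₗ[R] Z) (g : Z →ₗ[R] B),
        Function.Injective f ∧ Function.Surjective g ∧ LinearMap.range f = LinearMap.ker g ∧
        Ball R X (n + 1) A ∧ Ball R X 1 B ∧ IsSummand R M Z


/-- The kernel of `M × F → M, (m, f) ↦ x m - p f`: a module representing, up to shift and free
summands, the Koszul complex of `x` on `M`. -/
def koszulSyzygy {R M F : Type} [CommRing R] [AddCommGroup M] [Module R M] [AddCommGroup F]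
    [Module R F] (p : F →ₗ[R] M) (x : R) : Submodule R (M × F) :=
  LinearMap.ker (x • LinearMap.fst R M F - p ∘ₗ LinearMap.snd R M F)

section StablyAnn

variable {R M F : Type} [CommRing R] [AddCommGroup M] [Module R M] [AddCommGroup F] [Module R F]

theorem mem_koszulSyzygy {p : F →ₗ[R] M} {x : R} {z : M × F} :
    z ∈ koszulSyzygy p x ↔ x • z.1 = p z.2 := by
  simp [koszulSyzygy, sub_eq_zero]

theorem StablyAnn.exists_lift {a : R} (h : StablyAnn R M a) (p : F →ₗ[R] M)
    (hp : Function.Surjective p) : ∃ s : M →ₗ[R] F, ∀ m, p (s m) = a • m := by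
  obtain ⟨P, _, _, _, _, f, g, hfg⟩ := h
  obtain ⟨l, hl⟩ := Module.projective_lifting_property p g hp
  refine ⟨l ∘ₗ f, fun m => ?_⟩
  have h1 := LinearMap.congr_fun hl (f m)
  have h2 := LinearMap.congr_fun hfg m
  simp only [LinearMap.comp_apply, LinearMap.smul_apply, LinearMap.id_apply] at h1 h2 ⊢
  rw [h1, h2]

theorem StablyAnn.of_lift [Module.Finite R F] [Module.Projective R F] {a : R}
    (s : M →ₗ[R] F) (p : F →ₗ[R] M) (h : ∀ m, p (s m) = a • m) : StablyAnn R M a :=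
  ⟨F, inferInstance, inferInstance, inferInstance, inferInstance, s, p, by ext m; simpa using h m⟩

/-- The ideal of all `a` such that `a • id` factors through `p`. -/
def stableAnn (p : F →ₗ[R] M) : Ideal R where
  carrier := {a | ∃ s : M →ₗ[R] F, ∀ m, p (s m) = a • m}
  add_mem' := by
    rintro a b ⟨s, hs⟩ ⟨t, ht⟩
    exact ⟨s + t, fun m => by simp [hs, ht, add_smul]⟩
  zero_mem' := ⟨0, by simp⟩
  smul_mem' := by
    rintro c a ⟨s, hs⟩
    exact ⟨c • s, fun m => by simp [hs, mul_smul]⟩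

theorem mem_stableAnn_iff [Module.Finite R F] [Module.Projective R F] {p : F →ₗ[R] M}
    (hp : Function.Surjective p) {a : R} : a ∈ stableAnn p ↔ StablyAnn R M a :=
  ⟨fun ⟨s, hs⟩ => .of_lift s p hs, fun h => h.exists_lift p hp⟩

theorem stablyAnn_koszulSyzygy_self [Module.Finite R F] [Module.Projective R F]
    (p : F →ₗ[R] M) (x : R) : StablyAnn R (koszulSyzygy p x) x := by
  refine .of_lift (LinearMap.snd R M F ∘ₗ (koszulSyzygy p x).subtype)
    ((p.prod (x • LinearMap.id)).codRestrict _ fun f => by simp [mem_koszulSyzygy]) ?_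
  rintro ⟨⟨m, f⟩, hz⟩
  rw [mem_koszulSyzygy] at hz
  ext <;> simp [hz]

theorem StablyAnn.koszulSyzygy [Module.Finite R F] [Module.Projective R F] {a : R}
    (h : StablyAnn R M a) {p : F →ₗ[R] M} (hp : Function.Surjective p) (y : R) :
    StablyAnn R (koszulSyzygy p y) a := by
  obtain ⟨s, hs⟩ := h.exists_lift p hp
  let u : (F × F) →ₗ[R] (M × F) := LinearMap.coprod (p.prod (y • LinearMap.id))
    (LinearMap.prod 0 (a • LinearMap.id - s ∘ₗ p))
  refine .of_lift ((s.prodMap LinearMap.id) ∘ₗ (_root_.koszulSyzygy p y).subtype)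
    (u.codRestrict _ fun f => by simp [mem_koszulSyzygy, u, hs]) ?_
  rintro ⟨⟨m, f⟩, hz⟩
  rw [mem_koszulSyzygy] at hz
  simp only at hz
  ext <;> simp [u, hs, ← hz]

theorem exists_exact_koszulSyzygy_mul {p : F →ₗ[R] M} (hp : Function.Surjective p) (x y : R) :
    ∃ (f : koszulSyzygy p y →ₗ[R] (koszulSyzygy p (x * y) × F))
      (g : (koszulSyzygy p (x * y) × F) →ₗ[R] koszulSyzygy p x),
      Function.Injective f ∧ Function.Surjective g ∧ LinearMap.range f = LinearMap.ker g := by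
  let f : koszulSyzygy p y →ₗ[R] (koszulSyzygy p (x * y) × F) :=
    LinearMap.prod
      ((LinearMap.prodMap LinearMap.id (x • LinearMap.id) ∘ₗ
        (koszulSyzygy p y).subtype).codRestrict _ fun z => by
          have := mem_koszulSyzygy.1 z.2
          simp [mem_koszulSyzygy, mul_smul, this])
      (-(LinearMap.snd R M F ∘ₗ (koszulSyzygy p y).subtype))
  let g : (koszulSyzygy p (x * y) × F) →ₗ[R] koszulSyzygy p x :=
    (LinearMap.coprod
      (LinearMap.prodMap (y • LinearMap.id) LinearMap.id ∘ₗ (koszulSyzygy p (x * y)).subtype)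
      (p.prod (x • LinearMap.id))).codRestrict _ fun z => by
        have := mem_koszulSyzygy.1 z.1.2
        simp [mem_koszulSyzygy, ← this, mul_smul]
  have f_fst (z) : ((f z).1 : M × F) = (z.1.1, x • z.1.2) := rfl
  have f_snd (z) : (f z).2 = -z.1.2 := rfl
  have g_coe (z) : (g z : M × F) = (y • z.1.1.1 + p z.2, z.1.1.2 + x • z.2) := rfl
  refine ⟨f, g, ?_, ?_, le_antisymm ?_ ?_⟩
  · intro z w hzw
    have h1 := congrArg (fun v => (v.1 : M × F).1) hzw
    have h2 := congrArg Prod.snd hzw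
    simp only [f_fst, f_snd, neg_inj] at h1 h2
    exact Subtype.ext (Prod.ext h1 h2)
  · rintro ⟨⟨m, u⟩, hz⟩
    rw [mem_koszulSyzygy] at hz
    simp only at hz
    obtain ⟨v, rfl⟩ := hp m
    refine ⟨(⟨(0, u - x • v), by simp [mem_koszulSyzygy, hz]⟩, v), Subtype.ext ?_⟩
    simp [g_coe]
  · rintro _ ⟨z, rfl⟩
    have hz := mem_koszulSyzygy.1 z.2
    rw [LinearMap.mem_ker, Subtype.ext_iff, g_coe, f_fst, f_snd]
    simp [hz]
  · rintro ⟨⟨⟨m, u⟩, hz⟩, v⟩ hk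
    rw [LinearMap.mem_ker, Subtype.ext_iff, g_coe] at hk
    obtain ⟨h1, h2⟩ := Prod.ext_iff.1 hk
    have h1 : y • m = -p v := eq_neg_of_add_eq_zero_left h1
    have h2 : u = -(x • v) := eq_neg_of_add_eq_zero_left h2
    refine ⟨⟨(m, -v), by simp [mem_koszulSyzygy, h1]⟩, Prod.ext (Subtype.ext ?_) ?_⟩
    · simp [f_fst, h2]
    · simp [f_snd]

end StablyAnn

section Closure

variable {R : Type} [CommRing R] [IsNoetherianRing R] {I : Ideal R} {P : ModuleCat.{0} R → Prop}

/-- If `P` holds for the Koszul syzygy of `x`, it holds for those of all powers of `x`. -/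
theorem koszulSyzygy_pow_of_closed
    (hbase : ∀ N : ModuleCat.{0} R, Module.Finite R N → (∀ a ∈ I, StablyAnn R N a) → P N)
    (hsummand : ∀ N Z : ModuleCat.{0} R, Module.Finite R N → Module.Finite R Z →
        P Z → IsSummand R N Z → P N)
    (hext : ∀ (A Z B : ModuleCat.{0} R), Module.Finite R A → Module.Finite R Z →
        Module.Finite R B → ∀ (f : A →ₗ[R] Z) (g : Z →ₗ[R] B),
        Function.Injective f → Function.Surjective g → LinearMap.range f = LinearMap.ker g →
        P A → P B → P Z)
    {M F : Type} [AddCommGroup M] [Module R M] [Module.Finite R M]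
    [AddCommGroup F] [Module R F] [Module.Finite R F] [Module.Projective R F]
    {p : F →ₗ[R] M} (hp : Function.Surjective p) {x : R}
    (h : P (ModuleCat.of R (koszulSyzygy p x))) (n : ℕ) :
    P (ModuleCat.of R (koszulSyzygy p (x ^ n))) := by
  induction n with
  | zero =>
    refine hbase _ (inferInstanceAs (Module.Finite R (koszulSyzygy p (x ^ 0)))) fun a _ => ?_
    refine .of_lift (a • LinearMap.snd R M F ∘ₗ (koszulSyzygy p (x ^ 0)).subtype)
      ((p.prod LinearMap.id).codRestrict _ fun f => by simp [mem_koszulSyzygy]) ?_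
    rintro ⟨⟨m, f⟩, hz⟩
    rw [mem_koszulSyzygy] at hz
    simp only [pow_zero, one_smul] at hz
    ext <;> simp [hz]
  | succ n ih =>
    rw [pow_succ']
    obtain ⟨f, g, hf, hg, hfg⟩ := exists_exact_koszulSyzygy_mul hp x (x ^ n)
    have hZ : P (ModuleCat.of R (koszulSyzygy p (x * x ^ n) × F)) :=
      hext (ModuleCat.of R (koszulSyzygy p (x ^ n))) _ (ModuleCat.of R (koszulSyzygy p x))
        (inferInstanceAs (Module.Finite R (koszulSyzygy p (x ^ n))))
        (inferInstanceAs (Module.Finite R (koszulSyzygy p (x * x ^ n) × F)))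
        (inferInstanceAs (Module.Finite R (koszulSyzygy p x))) f g hf hg hfg ih h
    exact hsummand _ _ (inferInstanceAs (Module.Finite R (koszulSyzygy p (x * x ^ n))))
      (inferInstanceAs (Module.Finite R (koszulSyzygy p (x * x ^ n) × F))) hZ
      ⟨LinearMap.inl R (koszulSyzygy p (x * x ^ n)) F,
        LinearMap.fst R (koszulSyzygy p (x * x ^ n)) F, by ext <;> rfl⟩

theorem closed_of_forall_pow_stablyAnn
    (hbase : ∀ N : ModuleCat.{0} R, Module.Finite R N → (∀ a ∈ I, StablyAnn R N a) → P N)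
    (hsummand : ∀ N Z : ModuleCat.{0} R, Module.Finite R N → Module.Finite R Z →
        P Z → IsSummand R N Z → P N)
    (hext : ∀ (A Z B : ModuleCat.{0} R), Module.Finite R A → Module.Finite R Z →
        Module.Finite R B → ∀ (f : A →ₗ[R] Z) (g : Z →ₗ[R] B),
        Function.Injective f → Function.Surjective g → LinearMap.range f = LinearMap.ker g →
        P A → P B → P Z)
    (M : Type) [AddCommGroup M] [Module R M] [Module.Finite R M]
    (hM : ∀ x ∈ I, ∃ n : ℕ, StablyAnn R M (x ^ n)) : P (ModuleCat.of R M) := by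
  classical
  obtain ⟨s, hs⟩ := (isNoetherianRing_iff_ideal_fg R).1 inferInstance I
  suffices H : ∀ t : Finset R, t ⊆ s → ∀ (M : Type) [AddCommGroup M] [Module R M]
      [Module.Finite R M], (∀ x ∈ I, ∃ n : ℕ, StablyAnn R M (x ^ n)) →
      (∀ a ∈ s, a ∉ t → StablyAnn R M a) → P (ModuleCat.of R M) from
    H s subset_rfl M hM fun a ha ha' => absurd ha ha'
  intro t
  induction t using Finset.induction_on with
  | empty =>
    intro _ M _ _ _ _ hM
    obtain ⟨k, p, hp⟩ := Module.Finite.exists_fin' R M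
    refine hbase _ ‹_› fun a ha => ?_
    have hle : I ≤ stableAnn p := by
      rw [← hs]
      exact Ideal.span_le.2 fun b hb => (mem_stableAnn_iff hp).2 (hM b hb (by simp))
    exact (mem_stableAnn_iff hp).1 (hle ha)
  | insert x t _ ih =>
    intro hts M _ _ _ hI hM
    obtain ⟨hxs, hts⟩ := Finset.insert_subset_iff.1 hts
    obtain ⟨k, p, hp⟩ := Module.Finite.exists_fin' R M
    have hx : P (ModuleCat.of R (koszulSyzygy p x)) := by
      refine ih hts _ (fun z hz => (hI z hz).imp fun n hn => hn.koszulSyzygy hp x) ?_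
      intro a ha hat
      by_cases hax : a = x
      · exact hax ▸ stablyAnn_koszulSyzygy_self p a
      · exact (hM a ha (by simp [hax, hat])).koszulSyzygy hp x
    obtain ⟨n, hn⟩ := hI x (hs ▸ Ideal.subset_span hxs)
    obtain ⟨l, hl⟩ := hn.exists_lift p hp
    refine hsummand _ _ ‹_› (inferInstanceAs (Module.Finite R (koszulSyzygy p (x ^ n))))
      (koszulSyzygy_pow_of_closed hbase hsummand hext hp hx n)
      ⟨(LinearMap.id.prod l).codRestrict _ fun m => by simp [mem_koszulSyzygy, hl],
        LinearMap.fst R M _ ∘ₗ (koszulSyzygy p (x ^ n)).subtype, ?_⟩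
    ext m
    rfl

end Closure

section Localization

variable {R : Type} [CommRing R]

theorem exists_pow_stablyAnn [IsNoetherianRing R] {I : Ideal R} (M : Type) [AddCommGroup M]
    [Module R M] [Module.Finite R M]
    (hM : ∀ (p : Ideal R) [p.IsPrime], ¬ I ≤ p →
      Module.Free (Localization p.primeCompl) (LocalizedModule p.primeCompl M))
    {x : R} (hx : x ∈ I) : ∃ n : ℕ, StablyAnn R M (x ^ n) := by
  obtain ⟨k, π, hπ⟩ := Module.Finite.exists_fin' R M
  suffices h : x ∈ (stableAnn π).radical by
    obtain ⟨n, hn⟩ := h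
    exact ⟨n, (mem_stableAnn_iff hπ).1 hn⟩
  rw [Ideal.radical_eq_sInf, Submodule.mem_sInf]
  rintro (p : Ideal R) ⟨hle, hp⟩
  by_contra hxp
  have := hM p fun h => hxp (h hx)
  let S := p.primeCompl
  let fF := LocalizedModule.mkLinearMap S (Fin k → R)
  let fM := LocalizedModule.mkLinearMap S M
  have hsurj : Function.Surjective (LocalizedModule.map S π) :=
    LocalizedModule.map_surjective S π hπ
  obtain ⟨σ, hσ⟩ := Module.projective_lifting_property (LocalizedModule.map S π)
    LinearMap.id hsurj
  have := Module.finitePresentation_of_finite R M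
  obtain ⟨h, s, hs⟩ := Module.FinitePresentation.exists_lift_of_isLocalizedModule S fF
    ((σ.restrictScalars R) ∘ₗ fM)
  have hcomp : fM ∘ₗ (π ∘ₗ h) = fM ∘ₗ (s • LinearMap.id) := by
    ext m
    have h1 : fM (π (h m)) = LocalizedModule.map S π (fF (h m)) := by
      simp [fM, fF, LocalizedModule.mkLinearMap_apply, LocalizedModule.map_mk]
    have h2 : fF (h m) = s • σ (fM m) := LinearMap.congr_fun hs m
    have h3 : LocalizedModule.map S π (σ (fM m)) = fM m := LinearMap.congr_fun hσ (fM m)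
    have h4 : LocalizedModule.map S π (s • σ (fM m)) = s • LocalizedModule.map S π (σ (fM m)) :=
      ((LocalizedModule.map S π).restrictScalars R).map_smul (s : R) _
    change fM (π (h m)) = fM (s • m)
    rw [h1, h2, h4, h3]
    exact (fM.map_smul (s : R) m).symm
  obtain ⟨t, ht⟩ := Module.Finite.exists_smul_of_comp_eq_of_isLocalizedModule S fM _ _ hcomp
  refine (t * s).2 (hle ⟨t • h, fun m => ?_⟩)
  have h5 : (t : R) • π (h m) = (t : R) • (s : R) • m := LinearMap.congr_fun ht m
  change π ((t : R) • h m) = ((t : R) * (s : R)) • m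
  rw [map_smul, h5, mul_smul]

theorem StablyAnn.projective_localizedModule {M : Type} [AddCommGroup M] [Module R M] {a : R}
    (h : StablyAnn R M a) {S : Submonoid R} (ha : a ∈ S) :
    Module.Projective (Localization S) (LocalizedModule S M) := by
  obtain ⟨P, _, _, _, _, f, g, hfg⟩ := h
  let u := (IsLocalization.map_units (Localization S) (⟨a, ha⟩ : S)).unit
  refine Module.Projective.of_split (LocalizedModule.map S f)
    ((↑u⁻¹ : Localization S) • LocalizedModule.map S g) ?_
  ext m
  induction m with | _ m s
  have hm := LinearMap.congr_fun hfg m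
  simp only [LinearMap.comp_apply, LinearMap.smul_apply, LinearMap.id_apply] at hm
  simp only [LinearMap.comp_apply, LinearMap.smul_apply, LinearMap.id_apply,
    LocalizedModule.map_mk, hm]
  rw [← LocalizedModule.smul'_mk, ← algebraMap_smul (Localization S) a, ← mul_smul]
  have : (↑u⁻¹ : Localization S) * algebraMap R (Localization S) a = 1 := u.inv_mul
  rw [this, one_smul]

theorem projective_of_exact {A Z B : Type} [AddCommGroup A] [Module R A] [AddCommGroup Z]
    [Module R Z] [AddCommGroup B] [Module R B] [Module.Projective R A] [Module.Projective R B]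
    {f : A →ₗ[R] Z} {g : Z →ₗ[R] B} (hf : Function.Injective f) (hg : Function.Surjective g)
    (hfg : Function.Exact f g) : Module.Projective R Z := by
  obtain ⟨l, hl⟩ := Module.projective_lifting_property g LinearMap.id hg
  exact .of_equiv' (hfg.splitSurjectiveEquiv hf ⟨l, hl⟩).1.symm

end Localization

/-- The extension closure of mod_I(R) equals the category of finitely generated modules
that are locally free on the complement of V(I). -/
theorem ext_closure_modI (R : Type) [CommRing R] [IsNoetherianRing R] (I : Ideal R)
    (M : ModuleCat.{0} R) (hM : Module.Finite R M) :
    (∀ P : ModuleCat.{0} R → Prop,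
      -- P contains mod_I(R)
      (∀ N : ModuleCat.{0} R, Module.Finite R N → (∀ a ∈ I, StablyAnn R N a) → P N) →
      -- P is closed under finite direct sums
      (∀ N N' : ModuleCat.{0} R, Module.Finite R N → Module.Finite R N' →
        P N → P N' → P (ModuleCat.of R ((N × N' : Type)))) →
      -- P is closed under direct summands
      (∀ N Z : ModuleCat.{0} R, Module.Finite R N → Module.Finite R Z →
        P Z → IsSummand R N Z → P N) →
      -- P is closed under extensions
      (∀ (A Z B : ModuleCat.{0} R), Module.Finite R A → Module.Finite R Z → Module.Finite R B →
        ∀ (f : A →ₗ[R] Z) (g : Z →ₗ[R] B),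
        Function.Injective f → Function.Surjective g → LinearMap.range f = LinearMap.ker g →
        P A → P B → P Z) →
      P M) ↔
    (∀ (p : Ideal R) [p.IsPrime], ¬ I ≤ p →
      Module.Free (Localization p.primeCompl) (LocalizedModule p.primeCompl M)) := by
  constructor
  · intro h p _ hIp
    have : Module.Projective (Localization p.primeCompl) (LocalizedModule p.primeCompl M) := by
      refine h (fun N => Module.Projective (Localization p.primeCompl)
        (LocalizedModule p.primeCompl N)) ?_ ?_ ?_ ?_
      · intro N _ hN
        obtain ⟨a, haI, hap⟩ := Set.not_subset.1 hIp
        exact (hN a haI).projective_localizedModule (S := p.primeCompl) hap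
      · intro N N' _ _ _ _
        exact projective_of_exact
          (LocalizedModule.map_injective p.primeCompl (LinearMap.inl R N N')
            LinearMap.inl_injective)
          (LocalizedModule.map_surjective p.primeCompl (LinearMap.snd R N N')
            LinearMap.snd_surjective)
          (LocalizedModule.map_exact p.primeCompl _ _ Function.Exact.inl_snd)
      · rintro N Z _ _ _ ⟨i, r, hir⟩
        refine Module.Projective.of_split (LocalizedModule.map p.primeCompl i)
          (LocalizedModule.map p.primeCompl r) ?_
        ext m
        induction m with | _ m s
        have hm : r (i m) = m := LinearMap.congr_fun hir m
        simp [LocalizedModule.map_mk, hm]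
      · intro A Z B _ _ _ f g hf hg hfg _ _
        exact projective_of_exact
          (LocalizedModule.map_injective p.primeCompl f hf)
          (LocalizedModule.map_surjective p.primeCompl g hg)
          (LocalizedModule.map_exact p.primeCompl f g (LinearMap.exact_iff.2 hfg.symm))
    have : Module.Finite (Localization p.primeCompl) (LocalizedModule p.primeCompl M) :=
      Module.Finite.of_isLocalizedModule p.primeCompl (LocalizedModule.mkLinearMap p.primeCompl M)
    have : Module.Flat (Localization p.primeCompl) (LocalizedModule p.primeCompl M) :=
      Module.Flat.of_projective
    exact Module.free_of_flat_of_isLocalRing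
  · intro h P hbase _ hsummand hext
    exact closed_of_forall_pow_stablyAnn hbase hsummand hext M
      fun x hx => exists_pow_stablyAnn M h hx
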